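/- Let μ, ν be Borel probability measures on ℝ^N and let kr_{μ,ν} := (Q^μ, Q^ν)_# λ^N be their Knothe–Rosenblatt coupling. Then a coupling π of μ and ν equals kr_{μ,ν} if and only if for every k ≤ N, for π-a.e. (x,y), the conditional law under π of (x_k, y_k) given (x_1,…,x_{k-1}, y_1,…,y_{k-1}) is the quantile (comonotone) coupling of the conditional law of x_k given x_1,…,x_{k-1} under μ and the conditional law of y_k given y_1,…,y_{k-1} under ν. In particular kr_{μ,ν} is a bicausal coupling of μ and ν, and consequently AW_p(μ,ν) ≤ KR_p(μ,ν) for every p ∈ {0} ∪ [1,∞). -/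

import Mathlib

open MeasureTheory ProbabilityTheory Filter Set
open scoped ENNReal NNReal Topology

/-- Lebesgue measure on `(0,1)`. -/
noncomputable def lambda01 : Measure ℝ := volume.restrict (Set.Ioo (0:ℝ) 1)

/-- The `N`-fold product of Lebesgue measure on `(0,1)`. -/
noncomputable def lambdaN (N : ℕ) : Measure (Fin N → ℝ) :=
  Measure.pi fun _ => lambda01

/-- The open unit cube `(0,1)^N`. -/
def cube (N : ℕ) : Set (Fin N → ℝ) := {u | ∀ i, u i ∈ Set.Ioo (0:ℝ) 1}

/-- A map is triangular (adapted) if its `k`-th component depends only on the first `k`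
coordinates. -/
def Triangular {N : ℕ} (Q : (Fin N → ℝ) → Fin N → ℝ) : Prop :=
  ∀ (k : Fin N) (u v : Fin N → ℝ), (∀ j ≤ k, u j = v j) → Q u k = Q v k

/-- Monotonicity condition (inc) on a set `s`: the `k`-th component is increasing in the
`k`-th coordinate (the earlier coordinates being fixed). -/
def IncOn {N : ℕ} (Q : (Fin N → ℝ) → Fin N → ℝ) (s : Set (Fin N → ℝ)) : Prop :=
  ∀ k : Fin N, ∀ u ∈ s, ∀ v ∈ s, (∀ j < k, u j = v j) → u k ≤ v k → Q u k ≤ Q v k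

/-- Strict monotonicity condition (sinc) on a set `s`. -/
def StrictIncOn {N : ℕ} (Q : (Fin N → ℝ) → Fin N → ℝ) (s : Set (Fin N → ℝ)) : Prop :=
  ∀ k : Fin N, ∀ u ∈ s, ∀ v ∈ s, (∀ j < k, u j = v j) → u k < v k → Q u k < Q v k

/-- Consistency condition (con) on a set `s`: if changing only the `k`-th coordinate does not
change the `k`-th component, then it does not change any later component `m ≥ k`. -/
def ConOn {N : ℕ} (Q : (Fin N → ℝ) → Fin N → ℝ) (s : Set (Fin N → ℝ)) : Prop :=
  ∀ k m : Fin N, k ≤ m → ∀ u ∈ s, ∀ v ∈ s, (∀ j ≠ k, u j = v j) →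
    Q u k = Q v k → Q u m = Q v m

/-- A quantile process: a Borel triangular map satisfying (inc) and (con) on the unit cube. -/
structure IsQuantileProcess {N : ℕ} (Q : (Fin N → ℝ) → Fin N → ℝ) : Prop where
  measurable : Measurable Q
  triangular : Triangular Q
  inc : IncOn Q (cube N)
  con : ConOn Q (cube N)

/-- The (a.e. unique) quantile process of `μ`, chosen via Hilbert's epsilon operator. -/
noncomputable def quantileProcess {N : ℕ} (μ : Measure (Fin N → ℝ)) :
    (Fin N → ℝ) → Fin N → ℝ :=
  Classical.epsilon fun Q => IsQuantileProcess Q ∧ (lambdaN N).map Q = μ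

/-- The cost `|x - y|_p^p = ∑ₖ |xₖ - yₖ|^p`, valued in `ℝ≥0∞`. -/
noncomputable def pCost (p : ℝ) {N : ℕ} (x y : Fin N → ℝ) : ℝ≥0∞ :=
  ∑ k, ENNReal.ofReal (|x k - y k| ^ p)

/-- The bounded cost `|x - y| ∧ 1` used for `p = 0`. -/
noncomputable def cost0 {N : ℕ} (x y : Fin N → ℝ) : ℝ≥0∞ :=
  ENNReal.ofReal (min ‖x - y‖ 1)

/-- The `L_p(λ^N; ℝ^N)`-distance of two maps `(0,1)^N → ℝ^N`
(for `p = 0` the distance `∫ |f - g| ∧ 1 dλ^N` of convergence in probability). -/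
noncomputable def Ldist (p : ℝ) {N : ℕ} (f g : (Fin N → ℝ) → Fin N → ℝ) : ℝ≥0∞ :=
  if p = 0 then ∫⁻ u, cost0 (f u) (g u) ∂(lambdaN N)
  else (∫⁻ u, pCost p (f u) (g u) ∂(lambdaN N)) ^ p⁻¹

/-- `μ ∈ P_p(ℝ^N)`: a Borel probability measure with finite `p`-th moments
(no moment condition when `p = 0`). -/
def MemPp (p : ℝ) {N : ℕ} (μ : Measure (Fin N → ℝ)) : Prop :=
  IsProbabilityMeasure μ ∧
    (p = 0 ∨ ∫⁻ x, ∑ k, ENNReal.ofReal (|x k| ^ p) ∂μ < ⊤)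

/-- `T` is `p`-integrable w.r.t. `λ^N` (no condition when `p = 0`). -/
def FinLp (p : ℝ) {N : ℕ} (T : (Fin N → ℝ) → Fin N → ℝ) : Prop :=
  p = 0 ∨ ∫⁻ u, ∑ k, ENNReal.ofReal (|T u k| ^ p) ∂(lambdaN N) < ⊤

/-- The Knothe–Rosenblatt distance `KR_p(μ,ν)` (for `p = 0` the metric
`∫ |Q^μ - Q^ν| ∧ 1 dλ^N`). -/
noncomputable def KRdist (p : ℝ) {N : ℕ} (μ ν : Measure (Fin N → ℝ)) : ℝ≥0∞ :=
  Ldist p (quantileProcess μ) (quantileProcess ν)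

/-- `π` is a coupling of `μ` and `ν`. -/
def IsCoupling {α β : Type*} [MeasurableSpace α] [MeasurableSpace β]
    (π : Measure (α × β)) (μ : Measure α) (ν : Measure β) : Prop :=
  π.map Prod.fst = μ ∧ π.map Prod.snd = ν

/-- `κ` is a disintegration (regular conditional law) of `ρ` w.r.t. its first coordinate. -/
def Disintegrates {α β : Type*} [MeasurableSpace α] [MeasurableSpace β]
    (ρ : Measure (α × β)) (κ : Kernel α β) : Prop :=
  ∀ (A : Set α) (B : Set β), MeasurableSet A → MeasurableSet B →
    ρ (A ×ˢ B) = ∫⁻ a in A, κ a B ∂(ρ.map Prod.fst)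

/-- The first `k` coordinates of `x : ℝ^N`. -/
def restr {N : ℕ} (k : Fin N) (x : Fin N → ℝ) : Fin (k : ℕ) → ℝ :=
  fun j => x ⟨j, j.isLt.trans k.isLt⟩

/-- A coupling `π` of `μ` and `ν` is bicausal if, for every `k`, the conditional law under `π`
of `(x_k, y_k)` given `(x_{1:k-1}, y_{1:k-1})` is a.s. a coupling of the conditional law of
`x_k` given `x_{1:k-1}` under `μ` and that of `y_k` given `y_{1:k-1}` under `ν`. -/
def IsBicausal {N : ℕ} (μ ν : Measure (Fin N → ℝ))
    (π : Measure ((Fin N → ℝ) × (Fin N → ℝ))) : Prop :=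
  IsCoupling π μ ν ∧
  ∀ k : Fin N,
    ∃ (κ : Kernel ((Fin (k : ℕ) → ℝ) × (Fin (k : ℕ) → ℝ)) (ℝ × ℝ))
      (κμ κν : Kernel (Fin (k : ℕ) → ℝ) ℝ),
      IsMarkovKernel κ ∧ IsMarkovKernel κμ ∧ IsMarkovKernel κν ∧
      Disintegrates (μ.map fun x => (restr k x, x k)) κμ ∧
      Disintegrates (ν.map fun y => (restr k y, y k)) κν ∧
      Disintegrates (π.map fun xy => ((restr k xy.1, restr k xy.2), (xy.1 k, xy.2 k))) κ ∧
      ∀ᵐ ab ∂(π.map fun xy => (restr k xy.1, restr k xy.2)),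
        IsCoupling (κ ab) (κμ ab.1) (κν ab.2)

/-- The adapted Wasserstein distance `AW_p` (for `p = 0` with cost `|x - y| ∧ 1`). -/
noncomputable def AWdist (p : ℝ) {N : ℕ} (μ ν : Measure (Fin N → ℝ)) : ℝ≥0∞ :=
  ⨅ (π : Measure ((Fin N → ℝ) × (Fin N → ℝ))) (_ : IsBicausal μ ν π),
    if p = 0 then ∫⁻ xy, cost0 xy.1 xy.2 ∂π
    else (∫⁻ xy, pCost p xy.1 xy.2 ∂π) ^ p⁻¹

/-- `q` is a quantile function of `ρ ∈ P(ℝ)`: increasing on `(0,1)` and pushing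
Lebesgue measure on `(0,1)` forward to `ρ`. -/
def IsQuantileFun (ρ : Measure ℝ) (q : ℝ → ℝ) : Prop :=
  Measurable q ∧ MonotoneOn q (Set.Ioo (0:ℝ) 1) ∧ lambda01.map q = ρ

/-- `γ` is the quantile (comonotone) coupling of `ρ` and `σ`. -/
def IsQuantileCoupling (ρ σ : Measure ℝ) (γ : Measure (ℝ × ℝ)) : Prop :=
  ∃ qρ qσ : ℝ → ℝ, IsQuantileFun ρ qρ ∧ IsQuantileFun σ qσ ∧
    γ = lambda01.map fun u => (qρ u, qσ u)

instance : IsProbabilityMeasure lambda01 :=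
  ⟨by simp [lambda01]⟩

instance : NullSingletonClass lambda01 := by
  unfold lambda01; infer_instance

instance (N : ℕ) : IsProbabilityMeasure (lambdaN N) := by
  unfold lambdaN; infer_instance

lemma ae_mem_Ioo_lambda01 : ∀ᵐ t ∂lambda01, t ∈ Ioo (0:ℝ) 1 :=
  ae_restrict_mem measurableSet_Ioo

lemma ae_mem_cube_lambdaN (N : ℕ) : ∀ᵐ u ∂lambdaN N, u ∈ cube N := by
  have h (i : Fin N) : ∀ᵐ u ∂lambdaN N, u i ∈ Ioo (0:ℝ) 1 :=
    (measurePreserving_eval (fun _ : Fin N => lambda01) i).quasiMeasurePreserving.ae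
      ae_mem_Ioo_lambda01
  exact ae_all_iff.2 h

lemma measurableSet_cube (N : ℕ) : MeasurableSet (cube N) := by
  have : cube N = ⋂ i, (fun u : Fin N → ℝ => u i) ⁻¹' Ioo 0 1 := by
    ext u; simp [cube]
  rw [this]
  exact MeasurableSet.iInter fun i => measurable_pi_apply i measurableSet_Ioo

lemma update_mem_cube {N : ℕ} {u : Fin N → ℝ} (hu : u ∈ cube N) (k : Fin N) {t : ℝ}
    (ht : t ∈ Ioo (0:ℝ) 1) : Function.update u k t ∈ cube N := by
  intro j
  rcases eq_or_ne j k with rfl | hj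
  · simpa using ht
  · simpa [Function.update_of_ne hj] using hu j

/-! ### Quantile functions -/

/-- The left-continuous quantile function of `ρ` on `(0,1)`, extended by zero. -/
noncomputable def quantile (ρ : Measure ℝ) (t : ℝ) : ℝ :=
  open scoped Classical in if t ∈ Ioo (0:ℝ) 1 then sInf {x | t ≤ cdf ρ x} else 0

lemma quantile_le_iff (ρ : Measure ℝ) {t : ℝ} (ht : t ∈ Ioo (0:ℝ) 1) {x : ℝ} :
    quantile ρ t ≤ x ↔ t ≤ cdf ρ x := by
  rw [quantile, if_pos ht]
  obtain ⟨b, hb⟩ := ((tendsto_cdf_atBot ρ).eventually_lt_const ht.1).exists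
  obtain ⟨c, hc⟩ := ((tendsto_cdf_atTop ρ).eventually_const_lt ht.2).exists
  have hbdd : BddBelow {x | t ≤ cdf ρ x} := ⟨b, fun y hy => by
    by_contra! h
    exact absurd (hy.trans (monotone_cdf ρ h.le)) hb.not_ge⟩
  refine ⟨fun h => ?_, fun h => csInf_le hbdd h⟩
  refine le_trans ?_ (monotone_cdf ρ h)
  have hr := ((cdf ρ).right_continuous (sInf {x | t ≤ cdf ρ x})).mono_left
    (nhdsWithin_mono _ Ioi_subset_Ici_self)
  refine ge_of_tendsto hr ?_
  filter_upwards [self_mem_nhdsWithin] with y hy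
  obtain ⟨s, hs, hsy⟩ := exists_lt_of_csInf_lt ⟨c, hc.le⟩ hy
  exact le_trans hs (monotone_cdf ρ hsy.le)

lemma monotoneOn_quantile (ρ : Measure ℝ) : MonotoneOn (quantile ρ) (Ioo 0 1) := by
  intro s hs t ht hst
  exact (quantile_le_iff ρ hs).2 (hst.trans ((quantile_le_iff ρ ht).1 le_rfl))

lemma measurable_quantile_kernel {F : Type*} [MeasurableSpace F] (κ : Kernel F ℝ)
    [IsMarkovKernel κ] : Measurable fun p : F × ℝ => quantile (κ p.1) p.2 := by
  refine measurable_of_Iic fun x => ?_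
  have hI : MeasurableSet {p : F × ℝ | p.2 ∈ Ioo (0:ℝ) 1} := measurable_snd measurableSet_Ioo
  have hc : MeasurableSet {p : F × ℝ | p.2 ≤ (κ p.1).real (Iic x)} :=
    measurableSet_le measurable_snd
      ((κ.measurable_coe measurableSet_Iic).comp measurable_fst).ennreal_toReal
  have : (fun p : F × ℝ => quantile (κ p.1) p.2) ⁻¹' Iic x =
      ({p | p.2 ∈ Ioo (0:ℝ) 1} ∩ {p | p.2 ≤ (κ p.1).real (Iic x)}) ∪
      ({p | p.2 ∈ Ioo (0:ℝ) 1}ᶜ ∩ {_p | 0 ≤ x}) := by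
    ext p
    by_cases hp : p.2 ∈ Ioo (0:ℝ) 1
    · have h := quantile_le_iff (κ p.1) hp (x := x)
      rw [cdf_eq_real] at h
      simp only [mem_preimage, mem_Iic, mem_union, mem_inter_iff, mem_compl_iff, mem_ofPred_eq, hp,
        h, true_and, not_true_eq_false, false_and, or_false]
    · simp only [mem_preimage, mem_Iic, mem_union, mem_inter_iff, mem_compl_iff, mem_ofPred_eq, hp,
        quantile, if_false, not_false_eq_true, true_and, false_and, false_or]
  rw [this]
  exact (hI.inter hc).union (hI.compl.inter (.const _))

lemma measurable_quantile (ρ : Measure ℝ) [IsProbabilityMeasure ρ] : Measurable (quantile ρ) :=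
  (measurable_quantile_kernel (Kernel.const Unit ρ)).comp
    (measurable_prodMk_left (x := ()))

lemma lambda01_Iic {a : ℝ} (ha : a ≤ 1) : lambda01 (Iic a) = ENNReal.ofReal a := by
  rw [lambda01, Measure.restrict_apply measurableSet_Iic]
  refine le_antisymm ?_ ?_
  · calc volume (Iic a ∩ Ioo 0 1) ≤ volume (Ioc 0 a) :=
          measure_mono fun x hx => ⟨hx.2.1, hx.1⟩
      _ = _ := by simp
  · calc ENNReal.ofReal a = volume (Ioo 0 a) := by simp
      _ ≤ volume (Iic a ∩ Ioo 0 1) :=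
        measure_mono fun x hx => ⟨hx.2.le, hx.1, hx.2.trans_le ha⟩

lemma map_quantile (ρ : Measure ℝ) [IsProbabilityMeasure ρ] :
    lambda01.map (quantile ρ) = ρ := by
  have := Measure.isProbabilityMeasure_map (μ := lambda01) (measurable_quantile ρ).aemeasurable
  refine Measure.ext_of_Iic _ _ fun x => ?_
  rw [Measure.map_apply (measurable_quantile ρ) measurableSet_Iic, ← ofReal_cdf,
    ← lambda01_Iic (cdf_le_one ρ x)]
  refine measure_congr ?_
  filter_upwards [ae_mem_Ioo_lambda01] with t ht
  exact propext (quantile_le_iff ρ ht)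

lemma isQuantileFun_quantile (ρ : Measure ℝ) [IsProbabilityMeasure ρ] :
    IsQuantileFun ρ (quantile ρ) :=
  ⟨measurable_quantile ρ, monotoneOn_quantile ρ, map_quantile ρ⟩

lemma IsQuantileFun.le_cdf {ρ : Measure ℝ} [IsProbabilityMeasure ρ] {q : ℝ → ℝ}
    (hq : IsQuantileFun ρ q) {t x : ℝ} (ht : t ∈ Ioo (0:ℝ) 1) (h : q t ≤ x) : t ≤ cdf ρ x := by
  have h1 : ENNReal.ofReal t ≤ ENNReal.ofReal (cdf ρ x) := by
    rw [ofReal_cdf, ← lambda01_Iic ht.2.le]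
    conv_rhs => rw [← hq.2.2, Measure.map_apply hq.1 measurableSet_Iic]
    refine measure_mono_ae ?_
    filter_upwards [ae_mem_Ioo_lambda01] with s hs hst
    exact (hq.2.1 hs ht hst).trans h
  exact (ENNReal.ofReal_le_ofReal_iff (cdf_nonneg ρ x)).1 h1

lemma IsQuantileFun.cdf_le {ρ : Measure ℝ} [IsProbabilityMeasure ρ] {q : ℝ → ℝ}
    (hq : IsQuantileFun ρ q) {t x : ℝ} (ht : t ∈ Ioo (0:ℝ) 1) (h : x < q t) : cdf ρ x ≤ t := by
  have h1 : ENNReal.ofReal (cdf ρ x) ≤ ENNReal.ofReal t := by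
    rw [ofReal_cdf, ← lambda01_Iic ht.2.le]
    conv_lhs => rw [← hq.2.2, Measure.map_apply hq.1 measurableSet_Iic]
    refine measure_mono_ae ?_
    filter_upwards [ae_mem_Ioo_lambda01] with s hs hsx
    by_contra hst
    exact absurd ((hq.2.1 ht hs (not_le.1 hst).le).trans hsx) (not_le.2 h)
  exact (ENNReal.ofReal_le_ofReal_iff ht.1.le).1 h1

/-- Quantile functions of a given law are almost everywhere unique. -/
lemma IsQuantileFun.ae_eq {ρ : Measure ℝ} [IsProbabilityMeasure ρ] {q r : ℝ → ℝ}
    (hq : IsQuantileFun ρ q) (hr : IsQuantileFun ρ r) : q =ᵐ[lambda01] r := by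
  have hc : (range fun x : ℚ => cdf ρ (x : ℝ)).Countable := countable_range _
  filter_upwards [ae_mem_Ioo_lambda01, measure_eq_zero_iff_ae_notMem.1 (hc.measure_zero lambda01)]
    with t ht hn
  by_contra hne
  rcases lt_or_gt_of_ne hne with h | h
  · obtain ⟨x, h1, h2⟩ := exists_rat_btwn h
    exact hn ⟨x, le_antisymm (hr.cdf_le ht h2) (hq.le_cdf ht h1.le)⟩
  · obtain ⟨x, h1, h2⟩ := exists_rat_btwn h
    exact hn ⟨x, le_antisymm (hq.cdf_le ht h2) (hr.le_cdf ht h1.le)⟩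

lemma IsQuantileCoupling.isCoupling {ρ σ : Measure ℝ} {γ : Measure (ℝ × ℝ)}
    (h : IsQuantileCoupling ρ σ γ) : IsCoupling γ ρ σ := by
  obtain ⟨q, r, hq, hr, rfl⟩ := h
  have hm : Measurable fun u => (q u, r u) := hq.1.prodMk hr.1
  exact ⟨by rw [Measure.map_map measurable_fst hm]; exact hq.2.2,
    by rw [Measure.map_map measurable_snd hm]; exact hr.2.2⟩

lemma IsQuantileCoupling.eq_map_quantile {ρ σ : Measure ℝ} [IsProbabilityMeasure ρ]
    [IsProbabilityMeasure σ] {γ : Measure (ℝ × ℝ)} (h : IsQuantileCoupling ρ σ γ) :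
    γ = lambda01.map fun u => (quantile ρ u, quantile σ u) := by
  obtain ⟨q, r, hq, hr, rfl⟩ := h
  refine Measure.map_congr ?_
  filter_upwards [hq.ae_eq (isQuantileFun_quantile ρ), hr.ae_eq (isQuantileFun_quantile σ)]
    with t h1 h2
  rw [h1, h2]

/-! ### Resampling one coordinate -/

lemma measurable_update_prod {N : ℕ} (k : Fin N) :
    Measurable fun p : (Fin N → ℝ) × ℝ => Function.update p.1 k p.2 := by
  refine measurable_pi_lambda _ fun j => ?_
  rcases eq_or_ne j k with rfl | hj
  · simpa using measurable_snd
  · simpa [Function.update_of_ne hj] using measurable_fst.eval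

lemma map_update_prod (N : ℕ) (k : Fin N) :
    ((lambdaN N).prod lambda01).map (fun p => Function.update p.1 k p.2) = lambdaN N := by
  refine (Measure.pi_eq fun s hs => ?_).symm
  rw [Measure.map_apply (measurable_update_prod k) (MeasurableSet.univ_pi hs)]
  have hpre : (fun p : (Fin N → ℝ) × ℝ => Function.update p.1 k p.2) ⁻¹' univ.pi s =
      univ.pi (Function.update s k univ) ×ˢ s k := by
    ext p
    simp only [mem_preimage, Set.mem_pi, mem_univ, true_imp_iff, mem_prod]
    constructor
    · intro h
      refine ⟨fun j => ?_, by simpa using h k⟩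
      rcases eq_or_ne j k with rfl | hj
      · simp
      · simpa [Function.update_of_ne hj] using h j
    · rintro ⟨h, hk⟩ j
      rcases eq_or_ne j k with rfl | hj
      · simpa using hk
      · simpa [Function.update_of_ne hj] using h j
  rw [hpre, Measure.prod_prod, lambdaN, Measure.pi_pi,
    ← Finset.prod_erase_mul _ _ (Finset.mem_univ k),
    ← Finset.prod_erase_mul _ (fun i => lambda01 (s i)) (Finset.mem_univ k)]
  simp only [Function.update_self, measure_univ, mul_one]
  congr 1
  refine Finset.prod_congr rfl fun j hj => ?_
  rw [Function.update_of_ne (Finset.ne_of_mem_erase hj)]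

/-- The kernel sending `a` to the law of `g (a, ·)` under Lebesgue measure on `(0,1)`. -/
noncomputable def driveKernel {F E : Type*} [MeasurableSpace F] [MeasurableSpace E]
    (g : F × ℝ → E) : Kernel F E :=
  (Kernel.id ×ₖ Kernel.const F lambda01).map g

section Drive

variable {F E : Type*} [MeasurableSpace F] [MeasurableSpace E] {g : F × ℝ → E}

lemma driveKernel_apply (hg : Measurable g) (a : F) :
    driveKernel g a = lambda01.map fun t => g (a, t) := by
  rw [driveKernel, Kernel.map_apply _ hg, Kernel.prod_apply, Kernel.id_apply, Kernel.const_apply,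
    Measure.dirac_prod, Measure.map_map hg measurable_prodMk_left]
  rfl

lemma isMarkovKernel_driveKernel (hg : Measurable g) : IsMarkovKernel (driveKernel g) :=
  Kernel.IsMarkovKernel.map _ hg

/-- If `f` ignores the `k`-th coordinate, then `g (f u, u k)` has conditional law
`driveKernel g` given `f u`. -/
lemma map_prodMk_drive {N : ℕ} (k : Fin N) {f : (Fin N → ℝ) → F} (hf : Measurable f)
    (hfk : ∀ u t, f (Function.update u k t) = f u) (hg : Measurable g) :
    (lambdaN N).map (fun u => (f u, g (f u, u k))) = ((lambdaN N).map f) ⊗ₘ driveKernel g := by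
  have := isMarkovKernel_driveKernel hg
  have := Measure.isProbabilityMeasure_map (μ := lambdaN N) hf.aemeasurable
  have hm : Measurable fun u : Fin N → ℝ => (f u, g (f u, u k)) :=
    hf.prodMk (hg.comp (hf.prodMk (measurable_pi_apply k)))
  have := Measure.isProbabilityMeasure_map (μ := lambdaN N) hm.aemeasurable
  refine Measure.ext_prod fun {A B} hA hB => ?_
  rw [Measure.compProd_apply_prod hA hB,
    setLIntegral_map hA ((driveKernel g).measurable_coe hB) hf,
    Measure.map_apply hm (hA.prod hB)]
  conv_lhs => rw [← map_update_prod N k]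
  rw [Measure.map_apply (measurable_update_prod k) (hm (hA.prod hB)),
    Measure.prod_apply (measurable_update_prod k (hm (hA.prod hB))),
    ← lintegral_indicator (hf hA)]
  refine lintegral_congr fun u => ?_
  by_cases hu : f u ∈ A
  · rw [indicator_of_mem (by exact hu), driveKernel_apply hg,
      Measure.map_apply (by exact hg.comp measurable_prodMk_left) hB]
    congr 1
    ext t
    simp [hfk, hu]
  · rw [indicator_of_notMem (by exact hu)]
    convert measure_empty (μ := lambda01)
    ext t
    simp [hfk, hu]

end Drive

/-! ### Disintegrations -/

lemma disintegrates_iff {α β : Type*} [MeasurableSpace α] [MeasurableSpace β]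
    {ρ : Measure (α × β)} [IsFiniteMeasure ρ] {κ : Kernel α β} [IsMarkovKernel κ] :
    Disintegrates ρ κ ↔ ρ = (ρ.map Prod.fst) ⊗ₘ κ := by
  refine ⟨fun h => Measure.ext_prod fun {A B} hA hB => ?_, fun h A B hA hB => ?_⟩
  · rw [Measure.compProd_apply_prod hA hB, h A B hA hB]
  · conv_lhs => rw [h]
    rw [Measure.compProd_apply_prod hA hB]

lemma disintegrates_map_iff {Ω α β : Type*} [MeasurableSpace Ω] [MeasurableSpace α]
    [MeasurableSpace β] {P : Measure Ω} [IsFiniteMeasure P] {X : Ω → α} {Y : Ω → β}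
    (hX : Measurable X) (hY : Measurable Y) {κ : Kernel α β} [IsMarkovKernel κ] :
    Disintegrates (P.map fun ω => (X ω, Y ω)) κ ↔
      P.map (fun ω => (X ω, Y ω)) = (P.map X) ⊗ₘ κ := by
  rw [disintegrates_iff, Measure.map_map measurable_fst (hX.prodMk hY)]
  rfl

lemma ae_eq_of_compProd_eq {α : Type*} [MeasurableSpace α] {ρ : Measure α} [IsFiniteMeasure ρ]
    {κ η : Kernel α ℝ} [IsMarkovKernel κ] [IsMarkovKernel η] (h : ρ ⊗ₘ κ = ρ ⊗ₘ η) :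
    ∀ᵐ a ∂ρ, κ a = η a := by
  have h1 := eq_condKernel_of_measure_eq_compProd (ρ := ρ ⊗ₘ κ) κ (by simp [Measure.fst_compProd])
  have h2 := eq_condKernel_of_measure_eq_compProd (ρ := ρ ⊗ₘ κ) η
    (by rw [Measure.fst_compProd]; exact h)
  rw [Measure.fst_compProd] at h1 h2
  filter_upwards [h1, h2] with a h1 h2 using h1.trans h2.symm

/-- Laws of adapted processes are determined by their successive conditional laws. -/
lemma map_eq_of_condLaw_eq {N : ℕ} {Ω E : Type*} [MeasurableSpace Ω] [MeasurableSpace E]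
    {F : ℕ → Type*} [∀ k, MeasurableSpace (F k)] {P P' : Measure Ω}
    {X : ∀ k, k ≤ N → Ω → F k} {Y : Fin N → Ω → E} {step : ∀ k, F k × E → F (k + 1)}
    (hXm : ∀ k hk, Measurable (X k hk)) (hYm : ∀ k, Measurable (Y k))
    (hstep : ∀ k, Measurable (step k))
    (hX : ∀ (k : ℕ) (hk : k < N) ω, X (k + 1) hk ω = step k (X k hk.le ω, Y ⟨k, hk⟩ ω))
    (h0 : P.map (X 0 N.zero_le) = P'.map (X 0 N.zero_le))
    (κ : ∀ k : Fin N, Kernel (F k) E)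
    (hP : ∀ k : Fin N,
      P.map (fun ω => (X k k.2.le ω, Y k ω)) = (P.map (X k k.2.le)) ⊗ₘ κ k)
    (hP' : ∀ k : Fin N,
      P'.map (fun ω => (X k k.2.le ω, Y k ω)) = (P'.map (X k k.2.le)) ⊗ₘ κ k) :
    ∀ k hk, P.map (X k hk) = P'.map (X k hk) := by
  intro k
  induction k with
  | zero => exact fun _ => h0
  | succ k ih =>
    intro hk
    have hfun : X (k + 1) hk =
        step k ∘ fun ω => (X k (Nat.le_of_succ_le hk) ω, Y ⟨k, hk⟩ ω) := funext (hX k hk)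
    have hm := (hXm k (Nat.le_of_succ_le hk)).prodMk (hYm ⟨k, hk⟩)
    rw [hfun, ← Measure.map_map (hstep k) hm, ← Measure.map_map (hstep k) hm,
      hP ⟨k, hk⟩, hP' ⟨k, hk⟩]
    dsimp only
    rw [ih]

lemma map_eq_map_of_subsingleton {Ω β : Type*} [MeasurableSpace Ω] [MeasurableSpace β]
    [Subsingleton β] {P P' : Measure Ω} [IsProbabilityMeasure P] [IsProbabilityMeasure P']
    {f : Ω → β} (hf : Measurable f) : P.map f = P'.map f := by
  have := Measure.isProbabilityMeasure_map (μ := P) hf.aemeasurable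
  have := Measure.isProbabilityMeasure_map (μ := P') hf.aemeasurable
  ext s -
  rcases s.eq_empty_or_nonempty with rfl | hs
  · simp
  · rw [Subsingleton.eq_univ_of_nonempty hs, measure_univ, measure_univ]

lemma measurable_snoc {E : Type*} [MeasurableSpace E] (k : ℕ) :
    Measurable fun p : (Fin k → E) × E => (Fin.snoc p.1 p.2 : Fin (k + 1) → E) := by
  refine measurable_pi_lambda _ fun j => ?_
  refine Fin.lastCases ?_ (fun i => ?_) j
  · simpa using measurable_snd
  · simpa using measurable_fst.eval

lemma castLE_succ_eq_snoc {N k : ℕ} (hk : k < N) (x : Fin N → ℝ) :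
    (fun j : Fin (k + 1) => x (Fin.castLE hk j)) =
      Fin.snoc (α := fun _ => ℝ) (fun j : Fin k => x (Fin.castLE hk.le j)) (x ⟨k, hk⟩) := by
  funext j
  refine Fin.lastCases ?_ (fun i => ?_) j
  · rw [Fin.snoc_last]; rfl
  · rw [Fin.snoc_castSucc]; rfl

lemma measurable_restr {N : ℕ} (k : Fin N) : Measurable (restr k) :=
  measurable_pi_lambda _ fun _ => measurable_pi_apply _

lemma measure_eq_of_condLaw_eq {N : ℕ} {P P' : Measure (Fin N → ℝ)} [IsProbabilityMeasure P]
    [IsProbabilityMeasure P'] (κ : ∀ k : Fin N, Kernel (Fin k → ℝ) ℝ)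
    (hP : ∀ k, P.map (fun x => (restr k x, x k)) = (P.map (restr k)) ⊗ₘ κ k)
    (hP' : ∀ k, P'.map (fun x => (restr k x, x k)) = (P'.map (restr k)) ⊗ₘ κ k) : P = P' := by
  have hm (k : ℕ) (hk : k ≤ N) :
      Measurable fun (x : Fin N → ℝ) (j : Fin k) => x (Fin.castLE hk j) :=
    measurable_pi_lambda _ fun _ => measurable_pi_apply _
  have h := map_eq_of_condLaw_eq (P := P) (P' := P') (F := fun k => Fin k → ℝ)
    (X := fun k hk x j => x (Fin.castLE hk j)) (Y := fun k x => x k)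
    (step := fun k p => Fin.snoc p.1 p.2) hm measurable_pi_apply measurable_snoc
    (fun k hk x => castLE_succ_eq_snoc hk x)
    (map_eq_map_of_subsingleton (hm 0 N.zero_le)) κ hP hP' N le_rfl
  simpa using h

lemma measure_prod_eq_of_condLaw_eq {N : ℕ} {P P' : Measure ((Fin N → ℝ) × (Fin N → ℝ))}
    [IsProbabilityMeasure P] [IsProbabilityMeasure P']
    (κ : ∀ k : Fin N, Kernel ((Fin k → ℝ) × (Fin k → ℝ)) (ℝ × ℝ))
    (hP : ∀ k, P.map (fun z => ((restr k z.1, restr k z.2), (z.1 k, z.2 k))) =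
      (P.map fun z => (restr k z.1, restr k z.2)) ⊗ₘ κ k)
    (hP' : ∀ k, P'.map (fun z => ((restr k z.1, restr k z.2), (z.1 k, z.2 k))) =
      (P'.map fun z => (restr k z.1, restr k z.2)) ⊗ₘ κ k) : P = P' := by
  have hm1 (k : ℕ) (hk : k ≤ N) :
      Measurable fun (x : Fin N → ℝ) (j : Fin k) => x (Fin.castLE hk j) :=
    measurable_pi_lambda _ fun _ => measurable_pi_apply _
  have hm (k : ℕ) (hk : k ≤ N) := ((hm1 k hk).comp (measurable_fst (β := Fin N → ℝ))).prodMk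
    ((hm1 k hk).comp (measurable_snd (α := Fin N → ℝ)))
  have h := map_eq_of_condLaw_eq (P := P) (P' := P')
    (F := fun k => (Fin k → ℝ) × (Fin k → ℝ))
    (X := fun k hk z => (fun j => z.1 (Fin.castLE hk j), fun j => z.2 (Fin.castLE hk j)))
    (Y := fun k z => (z.1 k, z.2 k))
    (step := fun k p => (Fin.snoc p.1.1 p.2.1, Fin.snoc p.1.2 p.2.2)) hm
    (fun k => ((measurable_pi_apply k).comp measurable_fst).prodMk
      ((measurable_pi_apply k).comp measurable_snd))
    (fun k => ((measurable_snoc k).comp (measurable_fst.fst.prodMk measurable_snd.fst)).prodMk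
      ((measurable_snoc k).comp (measurable_fst.snd.prodMk measurable_snd.snd)))
    (fun k hk z => Prod.ext (castLE_succ_eq_snoc hk z.1) (castLE_succ_eq_snoc hk z.2))
    (map_eq_map_of_subsingleton (hm 0 N.zero_le)) κ hP hP' N le_rfl
  simpa using h

/-- A Borel map that is constant on the fibres of a Borel map `f` is `σ(f)`-measurable. -/
lemma Measurable.measurable_comap_of_factorsThrough {X Y Z : Type*} [MeasurableSpace X]
    [StandardBorelSpace X] [TopologicalSpace Y] [T2Space Y] [SecondCountableTopology Y]
    [mY : MeasurableSpace Y] [OpensMeasurableSpace Y] [MeasurableSpace Z] {f : X → Y} {g : X → Z}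
    (hf : Measurable f) (hg : Measurable g) (h : g.FactorsThrough f) :
    Measurable[mY.comap f] g := by
  intro s hs
  obtain ⟨u, hu1, hu2, hu⟩ := ((hg hs).analyticSet_image hf).measurablySeparable
    ((hg hs.compl).analyticSet_image hf) (by
      rw [Set.disjoint_left]
      rintro _ ⟨x, hx, rfl⟩ ⟨x', hx', hxx'⟩
      exact hx' ((h hxx').symm ▸ (show g x ∈ s from hx) : g x' ∈ s))
  refine ⟨u, hu, ?_⟩
  ext x
  refine ⟨fun hx => ?_, fun hx => hu1 (mem_image_of_mem f hx)⟩
  by_contra hxs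
  exact Set.disjoint_left.1 hu2 (mem_image_of_mem f hxs) hx

/-! ### Existence of quantile processes -/

/-- The triangular map driven by `q`: its `k`-th component is `q k` evaluated at the earlier components
and at the `k`-th coordinate. -/
noncomputable def drivenMap {N : ℕ} (q : ∀ k : Fin N, (Fin k → ℝ) × ℝ → ℝ)
    (u : Fin N → ℝ) (k : Fin N) : ℝ :=
  q k (fun j : Fin k => drivenMap q u ⟨j, j.2.trans k.2⟩, u k)
termination_by (k : ℕ)
decreasing_by exact j.2

section DrivenMap

variable {N : ℕ} {q : ∀ k : Fin N, (Fin k → ℝ) × ℝ → ℝ}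

lemma drivenMap_apply (u : Fin N → ℝ) (k : Fin N) :
    drivenMap q u k = q k (restr k (drivenMap q u), u k) := by
  rw [drivenMap]; rfl

lemma measurable_drivenMap (hq : ∀ k, Measurable (q k)) : Measurable (drivenMap q) := by
  refine measurable_pi_lambda _ fun k => ?_
  induction k using WellFoundedLT.induction with
  | ind k ih =>
    simp only [drivenMap_apply]
    exact (hq k).comp ((measurable_pi_lambda _ fun j => ih _ j.2).prodMk (measurable_pi_apply k))

lemma triangular_drivenMap : Triangular (drivenMap q) := by
  intro k u v h
  induction k using WellFoundedLT.induction with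
  | ind k ih =>
    have hr : restr k (drivenMap q u) = restr k (drivenMap q v) :=
      funext fun j => ih ⟨j, j.2.trans k.2⟩ j.2 fun i hi => h i (hi.trans (Fin.le_def.2 j.2.le))
    rw [drivenMap_apply, drivenMap_apply, hr, h k le_rfl]

lemma conOn_drivenMap (s : Set (Fin N → ℝ)) : ConOn (drivenMap q) s := by
  intro k m hkm u hu v hv huv hk
  induction m using WellFoundedLT.induction with
  | ind m ih =>
    rcases hkm.eq_or_lt with rfl | hkm
    · exact hk
    · have hr : restr m (drivenMap q u) = restr m (drivenMap q v) := by
        funext j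
        rcases le_or_gt k ⟨j, j.2.trans m.2⟩ with h | h
        · exact ih _ j.2 h
        · exact triangular_drivenMap _ _ _ fun i hi => huv i (hi.trans_lt h).ne
      rw [drivenMap_apply, drivenMap_apply, hr, huv m hkm.ne']

lemma incOn_drivenMap (hq : ∀ k a, MonotoneOn (fun t => q k (a, t)) (Ioo 0 1)) :
    IncOn (drivenMap q) (cube N) := by
  intro k u hu v hv h huv
  have hr : restr k (drivenMap q u) = restr k (drivenMap q v) :=
    funext fun j => triangular_drivenMap _ _ _ fun i hi => h i (lt_of_le_of_lt hi j.2)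
  rw [drivenMap_apply, drivenMap_apply, hr]
  exact hq k _ (hu k) (hv k) huv

lemma exists_isQuantileProcess_drive (hq : ∀ k, Measurable (q k))
    (hmono : ∀ k a, MonotoneOn (fun t => q k (a, t)) (Ioo 0 1)) :
    ∃ Q, IsQuantileProcess Q ∧ ∀ u k, Q u k = q k (restr k (Q u), u k) :=
  ⟨drivenMap q, ⟨measurable_drivenMap hq, triangular_drivenMap,
    incOn_drivenMap hmono, conOn_drivenMap _⟩, drivenMap_apply⟩

end DrivenMap

lemma Triangular.restr_update {N : ℕ} {Q : (Fin N → ℝ) → Fin N → ℝ} (hQ : Triangular Q)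
    (k : Fin N) (u : Fin N → ℝ) (t : ℝ) : restr k (Q (Function.update u k t)) = restr k (Q u) :=
  funext fun j => hQ _ _ _ fun _ hi => Function.update_of_ne (lt_of_le_of_lt hi j.2).ne _ _

lemma measurable_restr_prodMk {N : ℕ} (k : Fin N) :
    Measurable fun x : Fin N → ℝ => (restr k x, x k) :=
  (measurable_restr k).prodMk (measurable_pi_apply k)

lemma exists_condLaw {N : ℕ} (μ : Measure (Fin N → ℝ)) [IsProbabilityMeasure μ] (k : Fin N) :
    ∃ κ : Kernel (Fin k → ℝ) ℝ, IsMarkovKernel κ ∧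
      μ.map (fun x => (restr k x, x k)) = (μ.map (restr k)) ⊗ₘ κ := by
  have := Measure.isProbabilityMeasure_map (μ := μ) (measurable_restr_prodMk k).aemeasurable
  refine ⟨(μ.map fun x => (restr k x, x k)).condKernel, inferInstance, ?_⟩
  conv_lhs => rw [← (μ.map fun x => (restr k x, x k)).disintegrate
    (μ.map fun x => (restr k x, x k)).condKernel]
  rw [Measure.fst, Measure.map_map measurable_fst (measurable_restr_prodMk k)]
  rfl

lemma exists_isQuantileProcess {N : ℕ} (μ : Measure (Fin N → ℝ)) [IsProbabilityMeasure μ] :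
    ∃ Q, IsQuantileProcess Q ∧ (lambdaN N).map Q = μ := by
  choose κ hκ hμ using exists_condLaw μ
  let q (k : Fin N) (p : (Fin k → ℝ) × ℝ) : ℝ := quantile (κ k p.1) p.2
  have hq (k) : Measurable (q k) := measurable_quantile_kernel (κ k)
  obtain ⟨Q, hQ, hQq⟩ :=
    exists_isQuantileProcess_drive hq fun k a => monotoneOn_quantile (κ k a)
  refine ⟨Q, hQ, ?_⟩
  have := Measure.isProbabilityMeasure_map (μ := lambdaN N) hQ.measurable.aemeasurable
  refine measure_eq_of_condLaw_eq κ (fun k => ?_) hμ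
  have hdk : driveKernel (q k) = κ k := by
    ext1 a
    rw [driveKernel_apply (hq k)]
    exact map_quantile (κ k a)
  rw [Measure.map_map (measurable_restr_prodMk k) hQ.measurable,
    Measure.map_map (measurable_restr k) hQ.measurable, ← hdk,
    ← map_prodMk_drive k ((measurable_restr k).comp hQ.measurable)
      (hQ.triangular.restr_update k) (hq k)]
  exact Measure.map_congr (ae_of_all _ fun u => Prod.ext rfl (hQq u k))

lemma isQuantileProcess_quantileProcess {N : ℕ} (μ : Measure (Fin N → ℝ))
    [IsProbabilityMeasure μ] :
    IsQuantileProcess (quantileProcess μ) ∧ (lambdaN N).map (quantileProcess μ) = μ :=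
  Classical.epsilon_spec (exists_isQuantileProcess μ)

/-! ### Quantile processes are driven by conditional quantile functions -/

section Drive

variable {N : ℕ} {Q : (Fin N → ℝ) → Fin N → ℝ}

/-- The `k`-th component depends only on the earlier components and the `k`-th coordinate. -/
lemma IsQuantileProcess.apply_eq_of_restr_eq (hQ : IsQuantileProcess Q) {k : Fin N}
    {u v : Fin N → ℝ} (hu : u ∈ cube N) (hv : v ∈ cube N)
    (h : restr k (Q u) = restr k (Q v)) (huv : u k = v k) : Q u k = Q v k := by
  let w (i : ℕ) (j : Fin N) : ℝ := if (j : ℕ) < i then v j else u j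
  have hw (i) : w i ∈ cube N := fun j => by
    by_cases hj : (j : ℕ) < i
    · simpa [w, hj] using hv j
    · simpa [w, hj] using hu j
  have key : ∀ i ≤ (k : ℕ), ∀ m, Q (w i) m = Q u m := by
    intro i
    induction i with
    | zero => intro _ m; simp [w]
    | succ i ih =>
      intro hi m
      rw [← ih (Nat.le_of_succ_le hi) m]
      let i' : Fin N := ⟨i, (Nat.lt_of_succ_le hi).trans k.2⟩
      have hne (j : Fin N) (hj : j ≠ i') : w (i + 1) j = w i j := by
        have hj' : (j : ℕ) ≠ i := fun h => hj (Fin.ext h)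
        have : (j : ℕ) < i + 1 ↔ (j : ℕ) < i := by omega
        simp [w, this]
      rcases le_or_gt i' m with him | him
      · refine hQ.con i' m him _ (hw _) _ (hw _) hne ?_
        rw [ih (Nat.le_of_succ_le hi)]
        have h1 : Q u i' = Q v i' := congrFun h ⟨i, hi⟩
        rw [h1]
        refine hQ.triangular i' _ _ fun j hj => ?_
        have : (j : ℕ) < i + 1 := Nat.lt_succ_of_le hj
        simp [w, this]
      · exact hQ.triangular m _ _ fun j hj => hne j (hj.trans_lt him).ne
  rw [← key k le_rfl k]
  refine hQ.triangular k _ _ fun j hj => ?_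
  rcases hj.eq_or_lt with rfl | hj
  · simp [w, huv]
  · have : (j : ℕ) < k := hj
    simp [w, this]

lemma IsQuantileProcess.exists_drive (hQ : IsQuantileProcess Q) (k : Fin N) :
    ∃ G : (Fin k → ℝ) × ℝ → ℝ, Measurable G ∧ ∀ u ∈ cube N, ∀ t ∈ Ioo (0:ℝ) 1,
      Q (Function.update u k t) k = G (restr k (Q u), t) := by
  classical
  have hD : MeasurableSet (cube N ×ˢ Ioo (0:ℝ) 1) := (measurableSet_cube N).prod measurableSet_Ioo
  let c : (Fin N → ℝ) × ℝ → (Fin N → ℝ) × ℝ :=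
    (cube N ×ˢ Ioo (0:ℝ) 1).piecewise id fun _ => (fun _ => 1 / 2, 1 / 2)
  have hc : Measurable c := measurable_id.piecewise hD measurable_const
  have hcD (p) : c p ∈ cube N ×ˢ Ioo (0:ℝ) 1 := by
    by_cases hp : p ∈ cube N ×ˢ Ioo (0:ℝ) 1
    · simpa only [c, piecewise_eq_of_mem _ _ _ hp, id_eq] using hp
    · simp only [c, piecewise_eq_of_notMem _ _ _ hp]
      refine ⟨fun _ => ?_, ?_⟩ <;> norm_num
  let f (p : (Fin N → ℝ) × ℝ) : (Fin k → ℝ) × ℝ := (restr k (Q (c p).1), (c p).2)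
  let H (p : (Fin N → ℝ) × ℝ) : ℝ := Q (Function.update (c p).1 k (c p).2) k
  have hf : Measurable f :=
    ((measurable_restr k).comp (hQ.measurable.comp hc.fst)).prodMk hc.snd
  have hH : Measurable H :=
    (measurable_pi_apply k).comp (hQ.measurable.comp ((measurable_update_prod k).comp hc))
  have hfac : H.FactorsThrough f := by
    intro p p' hp
    obtain ⟨h1, h2⟩ := Prod.ext_iff.1 hp
    refine hQ.apply_eq_of_restr_eq (update_mem_cube (hcD p).1 k (hcD p).2)
      (update_mem_cube (hcD p').1 k (hcD p').2) ?_ (by simpa using h2)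
    rw [hQ.triangular.restr_update, hQ.triangular.restr_update]
    exact h1
  obtain ⟨G, hG, hGH⟩ := (hf.measurable_comap_of_factorsThrough hH hfac).exists_eq_measurable_comp
  refine ⟨G, hG, fun u hu t ht => ?_⟩
  have hcp : c (u, t) = (u, t) := piecewise_eq_of_mem _ _ _ (mk_mem_prod hu ht)
  have := congrFun hGH (u, t)
  simpa only [H, f, Function.comp_apply, hcp] using this

/-- The components of the quantile process are the conditional quantile functions. -/
lemma IsQuantileProcess.ae_eq_quantile (hQ : IsQuantileProcess Q) {μ : Measure (Fin N → ℝ)}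
    (hQμ : (lambdaN N).map Q = μ) (k : Fin N) {κ : Kernel (Fin k → ℝ) ℝ} [IsMarkovKernel κ]
    (hκ : μ.map (fun x => (restr k x, x k)) = (μ.map (restr k)) ⊗ₘ κ) :
    ∀ᵐ u ∂lambdaN N, Q u k = quantile (κ (restr k (Q u))) (u k) := by
  obtain ⟨G, hG, hQG⟩ := hQ.exists_drive k
  have := isMarkovKernel_driveKernel hG
  have hZ : Measurable fun u => restr k (Q u) := (measurable_restr k).comp hQ.measurable
  have hself : ∀ᵐ u ∂lambdaN N, Q u k = G (restr k (Q u), u k) := by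
    filter_upwards [ae_mem_cube_lambdaN N] with u hu
    simpa using hQG u hu (u k) (hu k)
  have hmapZ : μ.map (restr k) = (lambdaN N).map fun u => restr k (Q u) := by
    rw [← hQμ, Measure.map_map (measurable_restr k) hQ.measurable]; rfl
  have hlaw : μ.map (fun x => (restr k x, x k)) = (μ.map (restr k)) ⊗ₘ driveKernel G := by
    rw [hmapZ, ← map_prodMk_drive k hZ (hQ.triangular.restr_update k) hG, ← hQμ,
      Measure.map_map (measurable_restr_prodMk k) hQ.measurable]
    refine Measure.map_congr ?_
    filter_upwards [hself] with u hu
    exact Prod.ext rfl hu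
  have hprob : IsProbabilityMeasure μ :=
    hQμ ▸ Measure.isProbabilityMeasure_map (μ := lambdaN N) hQ.measurable.aemeasurable
  have hae := ae_eq_of_compProd_eq (hlaw.symm.trans hκ)
  rw [hmapZ] at hae
  have hae' := ae_of_ae_map hZ.aemeasurable hae
  suffices h : ∀ᵐ u ∂lambdaN N,
      G (restr k (Q u), u k) = quantile (κ (restr k (Q u))) (u k) by
    filter_upwards [hself, h] with u h1 h2 using h1.trans h2
  have hms : MeasurableSet
      {u | G (restr k (Q u), u k) = quantile (κ (restr k (Q u))) (u k)} := by
    have hZk := hZ.prodMk (measurable_pi_apply k)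
    exact measurableSet_eq_fun (hG.comp hZk) ((measurable_quantile_kernel κ).comp hZk)
  rw [← map_update_prod N k, ae_map_iff (measurable_update_prod k).aemeasurable hms]
  refine (Measure.ae_prod_iff_ae_ae (measurable_update_prod k hms)).2 ?_
  filter_upwards [hae', ae_mem_cube_lambdaN N] with u hu huc
  have hqf : IsQuantileFun (κ (restr k (Q u))) fun t => G (restr k (Q u), t) := by
    refine ⟨hG.comp measurable_prodMk_left, fun s hs t ht hst => ?_, ?_⟩
    · dsimp only
      rw [← hQG u huc s hs, ← hQG u huc t ht]
      refine hQ.inc k _ (update_mem_cube huc k hs) _ (update_mem_cube huc k ht)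
        (fun j hj => ?_) (by simpa using hst)
      rw [Function.update_of_ne hj.ne, Function.update_of_ne hj.ne]
    · rw [← hu, driveKernel_apply hG]
  filter_upwards [hqf.ae_eq (isQuantileFun_quantile _)] with t ht
  simpa only [mem_preimage, mem_ofPred_eq, hQ.triangular.restr_update, Function.update_self]
    using ht

end Drive

/-! ### Conditional laws of the Knothe–Rosenblatt coupling -/

section KnotheRosenblatt

variable {N : ℕ}

lemma measurable_restr_pair (k : Fin N) :
    Measurable fun z : (Fin N → ℝ) × (Fin N → ℝ) => (restr k z.1, restr k z.2) :=
  ((measurable_restr k).comp measurable_fst).prodMk ((measurable_restr k).comp measurable_snd)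

lemma measurable_apply_pair (k : Fin N) :
    Measurable fun z : (Fin N → ℝ) × (Fin N → ℝ) => (z.1 k, z.2 k) :=
  measurable_fst.eval.prodMk measurable_snd.eval

/-- Two conditional quantile functions driven by the same uniform variable. -/
noncomputable def quantilePair {k : ℕ} (κ η : Kernel (Fin k → ℝ) ℝ)
    (p : ((Fin k → ℝ) × (Fin k → ℝ)) × ℝ) : ℝ × ℝ :=
  (quantile (κ p.1.1) p.2, quantile (η p.1.2) p.2)

lemma measurable_quantilePair {k : ℕ} (κ η : Kernel (Fin k → ℝ) ℝ) [IsMarkovKernel κ]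
    [IsMarkovKernel η] : Measurable (quantilePair κ η) :=
  ((measurable_quantile_kernel κ).comp (measurable_fst.fst.prodMk measurable_snd)).prodMk
    ((measurable_quantile_kernel η).comp (measurable_fst.snd.prodMk measurable_snd))

lemma condLaw_map_quantileProcess {Q R : (Fin N → ℝ) → Fin N → ℝ} (hQ : IsQuantileProcess Q)
    (hR : IsQuantileProcess R) {μ ν : Measure (Fin N → ℝ)} (hQμ : (lambdaN N).map Q = μ)
    (hRν : (lambdaN N).map R = ν) (k : Fin N) {κ η : Kernel (Fin k → ℝ) ℝ} [IsMarkovKernel κ]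
    [IsMarkovKernel η] (hκ : μ.map (fun x => (restr k x, x k)) = (μ.map (restr k)) ⊗ₘ κ)
    (hη : ν.map (fun x => (restr k x, x k)) = (ν.map (restr k)) ⊗ₘ η) :
    ((lambdaN N).map fun u => (Q u, R u)).map
        (fun z => ((restr k z.1, restr k z.2), (z.1 k, z.2 k))) =
      (((lambdaN N).map fun u => (Q u, R u)).map fun z => (restr k z.1, restr k z.2)) ⊗ₘ
        driveKernel (quantilePair κ η) := by
  have hQR : Measurable fun u => (Q u, R u) := hQ.measurable.prodMk hR.measurable
  rw [Measure.map_map ((measurable_restr_pair k).prodMk (measurable_apply_pair k)) hQR,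
    Measure.map_map (measurable_restr_pair k) hQR,
    ← map_prodMk_drive k ((measurable_restr_pair k).comp hQR) ?_ (measurable_quantilePair κ η)]
  · refine Measure.map_congr ?_
    filter_upwards [hQ.ae_eq_quantile hQμ k hκ, hR.ae_eq_quantile hRν k hη] with u h1 h2
    exact Prod.ext rfl (Prod.ext h1 h2)
  · intro u t
    exact Prod.ext (hQ.triangular.restr_update k u t) (hR.triangular.restr_update k u t)

lemma isQuantileCoupling_driveKernel {k : ℕ} (κ η : Kernel (Fin k → ℝ) ℝ) [IsMarkovKernel κ]
    [IsMarkovKernel η] (a : (Fin k → ℝ) × (Fin k → ℝ)) :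
    IsQuantileCoupling (κ a.1) (η a.2) (driveKernel (quantilePair κ η) a) :=
  ⟨_, _, isQuantileFun_quantile _, isQuantileFun_quantile _,
    driveKernel_apply (measurable_quantilePair κ η) a⟩

end KnotheRosenblatt

/-- A coupling `π ∈ Π(μ,ν)` equals the Knothe–Rosenblatt coupling
`kr = (Q^μ, Q^ν)_# λ^N` iff all its successive conditional laws are a.s. quantile couplings
of the corresponding conditional laws of `μ` and `ν`. In particular `kr` is bicausal
and `AW_p(μ,ν) ≤ KR_p(μ,ν)` for `p ∈ {0} ∪ [1,∞)`. -/
theorem krCoupling_characterization (N : ℕ) (μ ν : Measure (Fin N → ℝ))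
    [IsProbabilityMeasure μ] [IsProbabilityMeasure ν]
    (kr : Measure ((Fin N → ℝ) × (Fin N → ℝ)))
    (hkr : kr = (lambdaN N).map fun u => (quantileProcess μ u, quantileProcess ν u)) :
    (∀ π : Measure ((Fin N → ℝ) × (Fin N → ℝ)), IsCoupling π μ ν →
      (π = kr ↔ ∀ k : Fin N,
        ∃ (κ : Kernel ((Fin (k : ℕ) → ℝ) × (Fin (k : ℕ) → ℝ)) (ℝ × ℝ))
          (κμ κν : Kernel (Fin (k : ℕ) → ℝ) ℝ),
          IsMarkovKernel κ ∧ IsMarkovKernel κμ ∧ IsMarkovKernel κν ∧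
          Disintegrates (μ.map fun x => (restr k x, x k)) κμ ∧
          Disintegrates (ν.map fun y => (restr k y, y k)) κν ∧
          Disintegrates (π.map fun xy => ((restr k xy.1, restr k xy.2), (xy.1 k, xy.2 k))) κ ∧
          ∀ᵐ ab ∂(π.map fun xy => (restr k xy.1, restr k xy.2)),
            IsQuantileCoupling (κμ ab.1) (κν ab.2) (κ ab))) ∧
    IsBicausal μ ν kr ∧
    (∀ p : ℝ, p = 0 ∨ 1 ≤ p → AWdist p μ ν ≤ KRdist p μ ν) := by
  obtain ⟨hQ, hQμ⟩ := isQuantileProcess_quantileProcess μ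
  obtain ⟨hR, hRν⟩ := isQuantileProcess_quantileProcess ν
  have hQR : Measurable fun u => (quantileProcess μ u, quantileProcess ν u) :=
    hQ.measurable.prodMk hR.measurable
  have hkrp : IsProbabilityMeasure kr :=
    hkr ▸ Measure.isProbabilityMeasure_map (μ := lambdaN N) hQR.aemeasurable
  have hcoup : IsCoupling kr μ ν := by
    rw [hkr]
    exact ⟨by rw [Measure.map_map measurable_fst hQR]; exact hQμ,
      by rw [Measure.map_map measurable_snd hQR]; exact hRν⟩
  have hforward : ∀ k : Fin N,
      ∃ (κ : Kernel ((Fin (k : ℕ) → ℝ) × (Fin (k : ℕ) → ℝ)) (ℝ × ℝ))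
        (κμ κν : Kernel (Fin (k : ℕ) → ℝ) ℝ),
        IsMarkovKernel κ ∧ IsMarkovKernel κμ ∧ IsMarkovKernel κν ∧
        Disintegrates (μ.map fun x => (restr k x, x k)) κμ ∧
        Disintegrates (ν.map fun y => (restr k y, y k)) κν ∧
        Disintegrates (kr.map fun xy => ((restr k xy.1, restr k xy.2), (xy.1 k, xy.2 k))) κ ∧
        ∀ᵐ ab ∂(kr.map fun xy => (restr k xy.1, restr k xy.2)),
          IsQuantileCoupling (κμ ab.1) (κν ab.2) (κ ab) := by
    intro k
    obtain ⟨κμ, _, hμ⟩ := exists_condLaw μ k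
    obtain ⟨κν, _, hν⟩ := exists_condLaw ν k
    have hm := isMarkovKernel_driveKernel (measurable_quantilePair κμ κν)
    refine ⟨driveKernel (quantilePair κμ κν), κμ, κν, hm, ‹_›, ‹_›,
      (disintegrates_map_iff (measurable_restr k) (measurable_pi_apply k)).2 hμ,
      (disintegrates_map_iff (measurable_restr k) (measurable_pi_apply k)).2 hν,
      (disintegrates_map_iff (measurable_restr_pair k) (measurable_apply_pair k)).2 ?_,
      ae_of_all _ (isQuantileCoupling_driveKernel κμ κν)⟩
    rw [hkr]
    exact condLaw_map_quantileProcess hQ hR hQμ hRν k hμ hν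
  have hbi : IsBicausal μ ν kr := by
    refine ⟨hcoup, fun k => ?_⟩
    obtain ⟨κ, κμ, κν, h1, h2, h3, h4, h5, h6, h7⟩ := hforward k
    exact ⟨κ, κμ, κν, h1, h2, h3, h4, h5, h6, h7.mono fun _ h => h.isCoupling⟩
  refine ⟨fun π hπ => ⟨fun h => h ▸ hforward, fun h => ?_⟩, hbi, fun p hp01 => ?_⟩
  · have hπp : IsProbabilityMeasure π := by
      have : IsProbabilityMeasure (π.map Prod.fst) := hπ.1 ▸ ‹_›
      exact Measure.isProbabilityMeasure_of_map Prod.fst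
    choose κ κμ κν h1 h2 h3 h4 h5 h6 h7 using h
    have hμ (k) := (disintegrates_map_iff (measurable_restr k) (measurable_pi_apply k)).1 (h4 k)
    have hν (k) := (disintegrates_map_iff (measurable_restr k) (measurable_pi_apply k)).1 (h5 k)
    have hπ' (k) :=
      (disintegrates_map_iff (measurable_restr_pair k) (measurable_apply_pair k)).1 (h6 k)
    refine measure_prod_eq_of_condLaw_eq
      (fun k => driveKernel (quantilePair (κμ k) (κν k))) (fun k => ?_) fun k => ?_
    · have hm := isMarkovKernel_driveKernel (measurable_quantilePair (κμ k) (κν k))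
      rw [hπ' k]
      refine Measure.compProd_congr ?_
      filter_upwards [h7 k] with ab hab
      rw [driveKernel_apply (measurable_quantilePair (κμ k) (κν k))]
      exact hab.eq_map_quantile
    · rw [hkr]
      exact condLaw_map_quantileProcess hQ hR hQμ hRν k (hμ k) (hν k)
  · refine (iInf₂_le kr hbi).trans ?_
    rw [KRdist, Ldist, hkr]
    split_ifs with hp
    · exact lintegral_map_le _ _
    · have hp0 : 0 ≤ p := hp01.elim ge_of_eq zero_le_one.trans
      exact ENNReal.rpow_le_rpow (lintegral_map_le _ _) (inv_nonneg.2 hp0)
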